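/- Let k be a field and consider the uniform matroid U(2,4) on the ground set {1,2,3,4}. The map sending a Grassmann–Plücker function Δ for U(2,4) over k to the cross ratio Δ(1,3)Δ(2,4) / (Δ(1,4)Δ(2,3)) induces a well-defined bijection from the set of rescaling classes of Grassmann–Plücker functions for U(2,4) over k to the set k ∖ {0, 1}. -/

import Mathlib

namespace Paper

variable (k : Type*) [Field k]

/-- A Grassmann–Plücker function for the uniform matroid `U(2,4)` on the ground set
`{0,1,2,3}` over the field `k`: `Δ i j ≠ 0` iff `i ≠ j` (the bases of `U(2,4)` are the
2-element subsets), `Δ` is alternating, and `Δ` satisfies the 3-term Plücker relation. -/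
def IsGPFunctionU24 (Δ : Fin 4 → Fin 4 → k) : Prop :=
  (∀ i j, Δ i j ≠ 0 ↔ i ≠ j) ∧
  (∀ i j, Δ j i = -Δ i j) ∧
  Δ 0 1 * Δ 2 3 - Δ 0 2 * Δ 1 3 + Δ 0 3 * Δ 1 2 = 0

/-- Two Grassmann–Plücker functions are rescaling equivalent if they differ by a global
nonzero constant `c` and nonzero scalars `d i` attached to the ground elements. -/
def RescalingEquivU24 (Δ Δ' : Fin 4 → Fin 4 → k) : Prop :=
  ∃ (c : kˣ) (d : Fin 4 → kˣ), ∀ i j, Δ' i j = (c : k) * (d i : k) * (d j : k) * Δ i j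

/-- The cross ratio `Δ(1,3)Δ(2,4) / (Δ(1,4)Δ(2,3))` of a Grassmann–Plücker function for
`U(2,4)` (with the ground set `{1,2,3,4}` written as `{0,1,2,3}`). -/
def crossRatioU24 (Δ : Fin 4 → Fin 4 → k) : k :=
  Δ 0 2 * Δ 1 3 / (Δ 0 3 * Δ 1 2)

end Paper

namespace Paper

variable {k : Type*} [Field k]

namespace IsGPFunctionU24

variable {Δ Δ' : Fin 4 → Fin 4 → k}

theorem ne_zero (h : IsGPFunctionU24 k Δ) {i j : Fin 4} (hij : i ≠ j) : Δ i j ≠ 0 :=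
  (h.1 i j).2 hij

theorem apply_self (h : IsGPFunctionU24 k Δ) (i : Fin 4) : Δ i i = 0 :=
  not_not.1 fun hi => (h.1 i i).1 hi rfl

theorem crossRatio_ne_zero (h : IsGPFunctionU24 k Δ) : crossRatioU24 k Δ ≠ 0 :=
  div_ne_zero (mul_ne_zero (h.ne_zero (by decide)) (h.ne_zero (by decide)))
    (mul_ne_zero (h.ne_zero (by decide)) (h.ne_zero (by decide)))

theorem crossRatio_sub_one (h : IsGPFunctionU24 k Δ) :
    crossRatioU24 k Δ - 1 = Δ 0 1 * Δ 2 3 / (Δ 0 3 * Δ 1 2) := by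
  have h03 : Δ 0 3 ≠ 0 := h.ne_zero (by decide)
  have h12 : Δ 1 2 ≠ 0 := h.ne_zero (by decide)
  unfold crossRatioU24
  field_simp
  linear_combination -h.2.2

theorem crossRatio_ne_one (h : IsGPFunctionU24 k Δ) : crossRatioU24 k Δ ≠ 1 := by
  rw [← sub_ne_zero, h.crossRatio_sub_one]
  exact div_ne_zero (mul_ne_zero (h.ne_zero (by decide)) (h.ne_zero (by decide)))
    (mul_ne_zero (h.ne_zero (by decide)) (h.ne_zero (by decide)))

/-- It suffices to compare two Grassmann–Plücker functions above the diagonal. -/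
theorem rescalingEquiv_of_lt (h : IsGPFunctionU24 k Δ) (h' : IsGPFunctionU24 k Δ')
    (c : kˣ) (d : Fin 4 → kˣ)
    (H : ∀ i j, i < j → Δ' i j = (c : k) * (d i : k) * (d j : k) * Δ i j) :
    RescalingEquivU24 k Δ Δ' := by
  refine ⟨c, d, fun i j => ?_⟩
  rcases lt_trichotomy i j with hij | rfl | hij
  · exact H i j hij
  · rw [h.apply_self, h'.apply_self, mul_zero]
  · rw [h.2.1 j i, h'.2.1 j i, H j i hij]
    ring

theorem rescalingEquiv_of_crossRatio_eq (h : IsGPFunctionU24 k Δ) (h' : IsGPFunctionU24 k Δ')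
    (hcr : crossRatioU24 k Δ = crossRatioU24 k Δ') : RescalingEquivU24 k Δ Δ' := by
  have hcr' : Δ 0 1 * Δ 2 3 / (Δ 0 3 * Δ 1 2) = Δ' 0 1 * Δ' 2 3 / (Δ' 0 3 * Δ' 1 2) := by
    rw [← h.crossRatio_sub_one, ← h'.crossRatio_sub_one, hcr]
  unfold crossRatioU24 at hcr
  have h01 : Δ 0 1 ≠ 0 := h.ne_zero (by decide)
  have h02 : Δ 0 2 ≠ 0 := h.ne_zero (by decide)
  have h03 : Δ 0 3 ≠ 0 := h.ne_zero (by decide)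
  have h12 : Δ 1 2 ≠ 0 := h.ne_zero (by decide)
  have h01' : Δ' 0 1 ≠ 0 := h'.ne_zero (by decide)
  have h02' : Δ' 0 2 ≠ 0 := h'.ne_zero (by decide)
  have h03' : Δ' 0 3 ≠ 0 := h'.ne_zero (by decide)
  have h12' : Δ' 1 2 ≠ 0 := h'.ne_zero (by decide)
  rw [div_eq_div_iff (mul_ne_zero h03 h12) (mul_ne_zero h03' h12')] at hcr hcr'
  let r01 : kˣ := Units.mk0 (Δ' 0 1 / Δ 0 1) (div_ne_zero h01' h01)
  let r02 : kˣ := Units.mk0 (Δ' 0 2 / Δ 0 2) (div_ne_zero h02' h02)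
  let r03 : kˣ := Units.mk0 (Δ' 0 3 / Δ 0 3) (div_ne_zero h03' h03)
  let r12 : kˣ := Units.mk0 (Δ' 1 2 / Δ 1 2) (div_ne_zero h12' h12)
  refine h.rescalingEquiv_of_lt h' (r01 * r02 / r12)
    ![1, r12 / r02, r12 / r01, r03 * r12 / (r01 * r02)] fun i j hij => ?_
  fin_cases i <;> fin_cases j <;> first
    | exact absurd hij (by decide)
    | simp [r01, r02, r03, r12, Units.val_div_eq_div_val]
      field_simp
      try linear_combination -hcr
      try linear_combination -hcr'

end IsGPFunctionU24

theorem RescalingEquivU24.crossRatio_eq {Δ Δ' : Fin 4 → Fin 4 → k}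
    (h : RescalingEquivU24 k Δ Δ') : crossRatioU24 k Δ = crossRatioU24 k Δ' := by
  obtain ⟨c, d, H⟩ := h
  have hu : (c : k) ^ 2 * d 0 * d 1 * d 2 * d 3 ≠ 0 := by simp
  unfold crossRatioU24
  rw [H 0 2, H 1 3, H 0 3, H 1 2, ← mul_div_mul_left _ _ hu]
  congr 1 <;> ring

theorem exists_isGPFunctionU24_crossRatio_eq {z : k} (h0 : z ≠ 0) (h1 : z ≠ 1) :
    ∃ Δ : Fin 4 → Fin 4 → k, IsGPFunctionU24 k Δ ∧ crossRatioU24 k Δ = z := by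
  have h1' : z - 1 ≠ 0 := sub_ne_zero.2 h1
  have h1'' : 1 - z ≠ 0 := sub_ne_zero.2 h1.symm
  refine ⟨![![0, z - 1, z, 1], ![1 - z, 0, 1, 1], ![-z, -1, 0, 1], ![-1, -1, -1, 0]],
    ⟨fun i j => ?_, fun i j => ?_, ?_⟩, ?_⟩
  · fin_cases i <;> fin_cases j <;> simp [h0, h1', h1'']
  · fin_cases i <;> fin_cases j <;> simp
  · simp
  · simp [crossRatioU24]

end Paper

/-- For a field `k`, the cross ratio `Δ ↦ Δ(1,3)Δ(2,4)/(Δ(1,4)Δ(2,3))`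
induces a well-defined bijection from the set of rescaling classes of Grassmann–Plücker
functions for `U(2,4)` over `k` to `k ∖ {0, 1}`: the cross ratio of a Grassmann–Plücker
function lies in `k ∖ {0,1}`; two Grassmann–Plücker functions are rescaling equivalent if
and only if they have the same cross ratio; and every element of `k ∖ {0,1}` is the cross
ratio of some Grassmann–Plücker function. -/
theorem crossRatio_bijection_on_rescaling_classes_of_U24 (k : Type*) [Field k] :
    (∀ Δ : Fin 4 → Fin 4 → k, Paper.IsGPFunctionU24 k Δ →
      Paper.crossRatioU24 k Δ ≠ 0 ∧ Paper.crossRatioU24 k Δ ≠ 1) ∧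
    (∀ Δ Δ' : Fin 4 → Fin 4 → k, Paper.IsGPFunctionU24 k Δ → Paper.IsGPFunctionU24 k Δ' →
      (Paper.RescalingEquivU24 k Δ Δ' ↔ Paper.crossRatioU24 k Δ = Paper.crossRatioU24 k Δ')) ∧
    (∀ z : k, z ≠ 0 → z ≠ 1 →
      ∃ Δ : Fin 4 → Fin 4 → k, Paper.IsGPFunctionU24 k Δ ∧ Paper.crossRatioU24 k Δ = z) := by
  refine ⟨fun Δ h => ⟨h.crossRatio_ne_zero, h.crossRatio_ne_one⟩, fun Δ Δ' h h' => ?_,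
    fun z h0 h1 => Paper.exists_isGPFunctionU24_crossRatio_eq h0 h1⟩
  exact ⟨fun H => H.crossRatio_eq, h.rescalingEquiv_of_crossRatio_eq h'⟩
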